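/- Suppose the good event 𝓔_s holds for every epoch s = 1,…,m (i.e., for every arm k and every s ≤ m, |r_k^s − μ_k| ≤ 2C^s/T^s + Δ_k^{s−1}/16). Then for every arm k, the empirical gap satisfies Δ_k^m ≥ (1/2)Δ_k − 3ρ^m − (3/4)·2^{−m}. -/

import Mathlib

/-- A geometrically discounted sum with ratio `1/8` satisfies a one-step recursion. -/
theorem sum_Icc_div_eight_pow_succ (C T : ℕ → ℝ) (n : ℕ) :
    ∑ s ∈ Finset.Icc 1 (n + 1), 2 * C s / ((8:ℝ) ^ (n + 1 - s) * T s) =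
      (∑ s ∈ Finset.Icc 1 n, 2 * C s / ((8:ℝ) ^ (n - s) * T s)) / 8
        + 2 * C (n + 1) / T (n + 1) := by
  rw [Finset.sum_Icc_succ_top (by omega), Finset.sum_div]
  congr 1
  · refine Finset.sum_congr rfl fun s hs => ?_
    rw [Nat.succ_sub (Finset.mem_Icc.1 hs).2, pow_succ, div_div]
    ring
  · simp


/-- Single-agent BARBAR analysis, Lemma 7: if the good event holds at every
epoch `s = 1,…,m`, then `Δ_k^m ≥ (1/2)Δ_k - 3ρ^m - (3/4)·2^{-m}` for every arm `k`. -/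
theorem stmt_2
    {ι : Type*} [Fintype ι] [Nonempty ι]
    (μ : ι → ℝ) (hμ0 : ∀ k, 0 ≤ μ k) (hμ1 : ∀ k, μ k ≤ 1)
    (kstar : ι) (hkstar : ∀ k, μ k ≤ μ kstar)
    (T C : ℕ → ℝ) (r : ι → ℕ → ℝ)
    (Δh : ι → ℕ → ℝ) (rstar : ℕ → ℝ)
    (hΔ0 : ∀ k, Δh k 0 = 1)
    (hrstar : ∀ m, 1 ≤ m →
      rstar m = Finset.univ.sup' Finset.univ_nonempty
        (fun k => r k m - Δh k (m - 1) / 16))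
    (hΔrec : ∀ m, 1 ≤ m → ∀ k,
      Δh k m = max ((2:ℝ) ^ (-(m:ℤ))) (rstar m - r k m))
    (ρ : ℕ → ℝ)
    (hρ : ∀ n, ρ n = ∑ s ∈ Finset.Icc 1 n, 2 * C s / ((8:ℝ) ^ (n - s) * T s))
    (m : ℕ) (hm : 1 ≤ m)
    (hT : ∀ s, 1 ≤ s → s ≤ m → 0 < T s)
    (hC : ∀ s, 1 ≤ s → s ≤ m → 0 ≤ C s)
    (hE : ∀ s, 1 ≤ s → s ≤ m → ∀ k,
      |r k s - μ k| ≤ 2 * C s / T s + Δh k (s - 1) / 16) :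
    ∀ k, (1/2) * (μ kstar - μ k) - 3 * ρ m - (3/4) * (2:ℝ) ^ (-(m:ℤ)) ≤ Δh k m := by
  have hρ0 : ρ 0 = 0 := by simp [hρ]
  have hρs (n : ℕ) : ρ (n + 1) = ρ n / 8 + 2 * C (n + 1) / T (n + 1) := by
    rw [hρ, hρ, sum_Icc_div_eight_pow_succ]
  have hpow (n : ℕ) : (2:ℝ) ^ (-((n + 1 : ℕ) : ℤ)) = (2:ℝ) ^ (-(n : ℤ)) / 2 := by
    simp only [zpow_neg, zpow_natCast, pow_succ, mul_inv]
    ring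
  have hpos (n : ℕ) : (0:ℝ) < (2:ℝ) ^ (-(n : ℤ)) := by positivity
  have hc (n : ℕ) (hn : n + 1 ≤ m) : 0 ≤ 2 * C (n + 1) / T (n + 1) :=
    div_nonneg (mul_nonneg zero_le_two (hC _ (by omega) hn)) (hT _ (by omega) hn).le
  have hρ_nonneg (n : ℕ) (hn : n ≤ m) : 0 ≤ ρ n := by
    induction n with
    | zero => exact hρ0.ge
    | succ n ih =>
      rw [hρs]
      linarith [ih (by omega), hc n hn]
  have upper (n : ℕ) (hn : n ≤ m) (k : ι) :
      Δh k n ≤ 2 * ((μ kstar - μ k) + (2:ℝ) ^ (-(n : ℤ)) + ρ n) := by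
    induction n with
    | zero =>
      rw [hΔ0, hρ0]
      norm_num
      linarith [hkstar k]
    | succ n ih =>
      have hr : rstar (n + 1) ≤ μ kstar + 2 * C (n + 1) / T (n + 1) := by
        rw [hrstar _ (by omega)]
        refine Finset.sup'_le _ _ fun j _ => ?_
        linarith [(abs_le.1 (hE _ (by omega) hn j)).2, hkstar j]
      have hk := (abs_le.1 (hE _ (by omega) hn k)).1
      have ih := ih (by omega)
      have hρn := hρ_nonneg n (by omega)
      rw [hΔrec _ (by omega), hρs, hpow]
      rw [Nat.add_sub_cancel] at hk
      apply max_le <;> linarith [hkstar k, hc n hn, hpos n]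
  intro k
  obtain ⟨n, rfl⟩ := Nat.exists_eq_add_of_le' hm
  have hr : r kstar (n + 1) - Δh kstar n / 16 ≤ rstar (n + 1) := by
    rw [hrstar _ hm]
    exact Finset.le_sup' (fun j => r j (n + 1) - Δh j (n + 1 - 1) / 16) (Finset.mem_univ kstar)
  have hks := (abs_le.1 (hE _ hm le_rfl kstar)).1
  have hk := (abs_le.1 (hE _ hm le_rfl k)).2
  rw [Nat.add_sub_cancel] at hks hk
  rw [hΔrec _ hm, hρs, hpow]
  refine le_max_of_le_right ?_
  linarith [upper n (by omega) k, upper n (by omega) kstar, hkstar k, hc n le_rfl]
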